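/- Let 𝒜 be an abelian category, 𝒳 closed under extensions and cokernels of monomorphisms, and 𝒲 an 𝒳-projective generator for 𝒳. For C with finite 𝒳-coresolution and n ≥ 0, the following are equivalent: (1) the 𝒳-coresolution dimension of C is at most n; (2) for every exact sequence 0 → C → X₀ → ⋯ → X₋ₙ₊₁ → U → 0 with all X₋ᵢ ∈ 𝒳, the cokernel U lies in 𝒳; (3) Ext^{n+i}(W, C) = 0 for every W ∈ 𝒲 and all i ≥ 1. -/

import Mathlib

open CategoryTheory CategoryTheory.Limits Opposite

universe v u

variable {A : Type u} [Category.{v} A] [Abelian A]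

/-- `IsSES f g` : `0 → X → Y → Z → 0` is a short exact sequence. -/
def IsSES {X Y Z : A} (f : X ⟶ Y) (g : Y ⟶ Z) : Prop :=
  ∃ w : f ≫ g = 0, (ShortComplex.mk f g w).ShortExact

/-- `HasCoresLE S n C` : `C` admits a coresolution `0 → C → X₀ → ⋯ → X₋ₙ → 0`
with all terms in `S`. -/
def HasCoresLE (S : Set A) : ℕ → A → Prop
  | 0, C => C ∈ S
  | n+1, C => ∃ (X K : A) (f : C ⟶ X) (g : X ⟶ K), X ∈ S ∧ IsSES f g ∧ HasCoresLE S n K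

/-- `S` is closed under extensions. -/
def ExtClosed (S : Set A) : Prop :=
  ∀ ⦃X Y Z : A⦄ (f : X ⟶ Y) (g : Y ⟶ Z), IsSES f g → X ∈ S → Z ∈ S → Y ∈ S

/-- `S` is closed under cokernels of monomorphisms. -/
def CokerClosed (S : Set A) : Prop :=
  ∀ ⦃X Y Z : A⦄ (f : X ⟶ Y) (g : Y ⟶ Z), IsSES f g → X ∈ S → Y ∈ S → Z ∈ S

/-- `S` is closed under kernels of epimorphisms. -/
def KerClosed (S : Set A) : Prop :=
  ∀ ⦃X Y Z : A⦄ (f : X ⟶ Y) (g : Y ⟶ Z), IsSES f g → Y ∈ S → Z ∈ S → X ∈ S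

/-- `W` is a generator for `X` : every object of `X` receives an epimorphism from
an object of `W` with kernel in `X`. -/
def IsGen (W X : Set A) : Prop :=
  W ⊆ X ∧ ∀ C ∈ X, ∃ (X' W₀ : A) (f : X' ⟶ W₀) (g : W₀ ⟶ C),
    W₀ ∈ W ∧ X' ∈ X ∧ IsSES f g

/-- `Extⁱ(X, Y) = 0`. -/
def ExtVanish [EnoughProjectives A] (i : ℕ) (X Y : A) : Prop :=
  IsZero (((Ext ℤ A i).obj (op X)).obj Y)

/-- `W` is `X`-projective: `Extⁱ(W, X) = 0` for all `i ≥ 1`. -/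
def IsXProj [EnoughProjectives A] (W X : Set A) : Prop :=
  ∀ W' ∈ W, ∀ X' ∈ X, ∀ i : ℕ, 1 ≤ i → ExtVanish i W' X'

/-- `CoresWithCokernel S n C U` : there is an exact sequence
`0 → C → X₀ → ⋯ → X₋ₙ₊₁ → U → 0` with `n` middle terms in `S` and end term `U`. -/
def CoresWithCokernel (S : Set A) : ℕ → A → A → Prop
  | 0, C, U => Nonempty (C ≅ U)
  | n+1, C, U => ∃ (X K : A) (f : C ⟶ X) (g : X ⟶ K),
      X ∈ S ∧ IsSES f g ∧ CoresWithCokernel S n K U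

lemma IsSES.mk_ker {X Y Z : A} {f : X ⟶ Y} {g : Y ⟶ Z} [Mono f] [Epi g] (w : f ≫ g = 0)
    (h : ∀ (T : A) (t : T ⟶ Y), t ≫ g = 0 → ∃ l : T ⟶ X, l ≫ f = t) : IsSES f g := by
  refine ⟨w, ?_⟩
  have hl : IsLimit (KernelFork.ofι f w) :=
    KernelFork.IsLimit.ofι' f w (fun {T} t ht => ⟨(h T t ht).choose, (h T t ht).choose_spec⟩)
  exact { exact := ShortComplex.exact_of_f_is_kernel _ hl, mono_f := ‹_›, epi_g := ‹_› }

lemma IsSES.mk_coker {X Y Z : A} {f : X ⟶ Y} {g : Y ⟶ Z} [Mono f] [Epi g] (w : f ≫ g = 0)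
    (h : ∀ (T : A) (t : Y ⟶ T), f ≫ t = 0 → ∃ l : Z ⟶ T, g ≫ l = t) : IsSES f g := by
  refine ⟨w, ?_⟩
  have hl : IsColimit (CokernelCofork.ofπ g w) :=
    CokernelCofork.IsColimit.ofπ' g w
      (fun {T} t ht => ⟨(h T t ht).choose, (h T t ht).choose_spec⟩)
  exact { exact := ShortComplex.exact_of_g_is_cokernel _ hl, mono_f := ‹_›, epi_g := ‹_› }

lemma IsSES.w {X Y Z : A} {f : X ⟶ Y} {g : Y ⟶ Z} (h : IsSES f g) : f ≫ g = 0 := h.1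

lemma IsSES.mono {X Y Z : A} {f : X ⟶ Y} {g : Y ⟶ Z} (h : IsSES f g) : Mono f := h.2.mono_f

lemma IsSES.epi {X Y Z : A} {f : X ⟶ Y} {g : Y ⟶ Z} (h : IsSES f g) : Epi g := h.2.epi_g

lemma IsSES.lift {X Y Z : A} {f : X ⟶ Y} {g : Y ⟶ Z} (h : IsSES f g) {T : A} (t : T ⟶ Y)
    (ht : t ≫ g = 0) : ∃ l : T ⟶ X, l ≫ f = t := by
  obtain ⟨w, h⟩ := h
  exact ⟨_, (KernelFork.IsLimit.lift' h.fIsKernel t ht).2⟩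

lemma IsSES.desc {X Y Z : A} {f : X ⟶ Y} {g : Y ⟶ Z} (h : IsSES f g) {T : A} (t : Y ⟶ T)
    (ht : f ≫ t = 0) : ∃ l : Z ⟶ T, g ≫ l = t := by
  obtain ⟨w, h⟩ := h
  exact ⟨_, (CokernelCofork.IsColimit.desc' h.gIsCokernel t ht).2⟩

/-- pulling back a short exact sequence -/
lemma IsSES.pull {X Y Z D P : A} {f : X ⟶ Y} {g : Y ⟶ Z} (h : IsSES f g) {k : D ⟶ Z}
    {p : P ⟶ Y} {q : P ⟶ D} (sq : IsPullback p q g k) : ∃ a : X ⟶ P, a ≫ p = f ∧ IsSES a q := by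
  have := h.mono
  have := h.epi
  have hq : Epi q := by
    have : q = sq.isoPullback.hom ≫ pullback.snd g k := by simp
    rw [this]
    infer_instance
  have hz : f ≫ g = 0 ≫ k := by rw [h.w, zero_comp]
  have ha : sq.lift f 0 hz ≫ p = f := by simp
  have : Mono (sq.lift f 0 hz) := mono_of_mono_fac ha
  refine ⟨sq.lift f 0 hz, ha, IsSES.mk_ker (by simp) ?_⟩
  intro T t ht
  obtain ⟨l, hl⟩ := h.lift (t ≫ p) (by rw [Category.assoc, sq.w, reassoc_of% ht, zero_comp])
  exact ⟨l, sq.hom_ext (by simp [hl]) (by simp [ht])⟩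

/-- pushing out a short exact sequence -/
lemma IsSES.push {X Y Z D P : A} {f : X ⟶ Y} {g : Y ⟶ Z} (h : IsSES f g) {k : X ⟶ D}
    {p : Y ⟶ P} {q : D ⟶ P} (sq : IsPushout f k p q) : ∃ a : P ⟶ Z, p ≫ a = g ∧ IsSES q a := by
  have := h.mono
  have := h.epi
  have hq : Mono q := by
    have : q = pushout.inr f k ≫ sq.isoPushout.inv := by simp
    rw [this]
    infer_instance
  have hz : f ≫ g = k ≫ 0 := by rw [h.w, comp_zero]
  have ha : p ≫ sq.desc g 0 hz = g := by simp
  have : Epi (sq.desc g 0 hz) := epi_of_epi_fac ha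
  refine ⟨sq.desc g 0 hz, ha, IsSES.mk_coker (by simp) ?_⟩
  intro T t ht
  obtain ⟨l, hl⟩ := h.desc (p ≫ t) (by rw [← Category.assoc, sq.w, Category.assoc, ht, comp_zero])
  exact ⟨l, sq.hom_ext (by simp [hl]) (by simp [ht])⟩

lemma IsSES.pullback_epi {X Y Z D E : A} {f : X ⟶ Y} {g : Y ⟶ Z} {e : E ⟶ D} {k : D ⟶ Z}
    (h : IsSES f g) (h' : IsSES e k) :
    ∃ (P : A) (a : X ⟶ P) (b : P ⟶ D) (c : E ⟶ P) (d : P ⟶ Y), IsSES a b ∧ IsSES c d := by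
  obtain ⟨a, _, ha⟩ := h.pull (IsPullback.of_hasPullback g k)
  obtain ⟨c, _, hc⟩ := h'.pull (IsPullback.of_hasPullback g k).flip
  exact ⟨_, a, _, c, _, ha, hc⟩

lemma IsSES.pushout_mono {X Y Z D E : A} {f : X ⟶ Y} {g : Y ⟶ Z} {k : X ⟶ D} {e : D ⟶ E}
    (h : IsSES f g) (h' : IsSES k e) :
    ∃ (P : A) (a : D ⟶ P) (b : P ⟶ Z) (c : Y ⟶ P) (d : P ⟶ E), IsSES a b ∧ IsSES c d := by
  obtain ⟨a, _, ha⟩ := h.push (IsPushout.of_hasPushout f k)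
  obtain ⟨c, _, hc⟩ := h'.push (IsPushout.of_hasPushout f k).flip
  exact ⟨_, _, a, _, c, ha, hc⟩

lemma IsSES.pullback_mono {X Y Z D K : A} {f : X ⟶ Y} {g : Y ⟶ Z} {k : D ⟶ Z} {e : Z ⟶ K}
    (h : IsSES f g) (h' : IsSES k e) :
    ∃ (P : A) (a : X ⟶ P) (b : P ⟶ D) (c : P ⟶ Y) (d : Y ⟶ K), IsSES a b ∧ IsSES c d := by
  have sq := IsPullback.of_hasPullback g k
  obtain ⟨a, _, ha⟩ := h.pull sq
  have := h'.mono
  have := h'.epi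
  have := h.epi
  refine ⟨_, a, _, pullback.fst g k, g ≫ e, ha, IsSES.mk_ker ?_ ?_⟩
  · rw [← Category.assoc, sq.w, Category.assoc, h'.w, comp_zero]
  · intro T t ht
    obtain ⟨l, hl⟩ := h'.lift (t ≫ g) (by simpa using ht)
    exact ⟨sq.lift t l hl.symm, by simp⟩

lemma IsSES.pushout_epi {X Y Z D K : A} {f : X ⟶ Y} {g : Y ⟶ Z} {k : Y ⟶ D} {e : D ⟶ K}
    (h : IsSES f g) (h' : IsSES k e) :
    ∃ (P : A) (a : X ⟶ D) (b : D ⟶ P) (c : Z ⟶ P) (d : P ⟶ K), IsSES a b ∧ IsSES c d := by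
  have sq := IsPushout.of_hasPushout k g
  obtain ⟨d, _, hd⟩ := h'.push sq
  have := h'.mono
  have := h.mono
  have := h.epi
  refine ⟨_, f ≫ k, pushout.inl k g, _, d, IsSES.mk_coker ?_ ?_, hd⟩
  · rw [Category.assoc, sq.w, ← Category.assoc, h.w, zero_comp]
  · intro T t ht
    obtain ⟨l, hl⟩ := h.desc (k ≫ t) (by simpa using ht)
    exact ⟨sq.desc t l hl.symm, by simp⟩

section ExtTools

open CategoryTheory.Abelian

/-- Vanishing of the derived-category `Ext`. -/
def DExtVanish [HasExt.{v} A] (i : ℕ) (X Y : A) : Prop :=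
  ∀ x : Abelian.Ext.{v} X Y i, x = 0

lemma extVanish_iff [EnoughProjectives A] [HasExt.{v} A] (i : ℕ) (X Y : A) :
    ExtVanish (i + 1) X Y ↔ DExtVanish (i + 1) X Y := by
  let R := projectiveResolution X
  have e : IsZero (((_root_.Ext ℤ A (i + 1)).obj (op X)).obj Y) ↔
      ∀ f : R.complex.X (i + 1) ⟶ Y, R.complex.d (i + 2) (i + 1) ≫ f = 0 →
        ∃ g : R.complex.X i ⟶ Y, R.complex.d (i + 1) i ≫ g = f := by
    rw [(R.isoExt (R := ℤ) (i + 1) Y).isZero_iff,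
      ← HomologicalComplex.exactAt_iff_isZero_homology,
      HomologicalComplex.exactAt_iff' _ i (i + 1) (i + 2) (by simp) (by simp),
      ShortComplex.moduleCat_exact_iff]
    rfl
  unfold ExtVanish
  rw [e]
  constructor
  · intro h x
    obtain ⟨f, hf, rfl⟩ := R.extMk_surjective x (i + 2) rfl
    exact (R.extMk_eq_zero_iff f _ rfl hf i rfl).2 (h f hf)
  · intro h f hf
    exact (R.extMk_eq_zero_iff f _ rfl hf i rfl).1 (h _)

variable [HasExt.{v} A]

lemma DExtVanish.of_cov₁ {X Y Z T : A} {f : X ⟶ Y} {g : Y ⟶ Z} (h : IsSES f g) {i : ℕ}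
    (h1 : DExtVanish i T Z) (h2 : DExtVanish (i + 1) T Y) : DExtVanish (i + 1) T X := by
  obtain ⟨w, h⟩ := h
  intro x
  obtain ⟨y, rfl⟩ := Ext.covariant_sequence_exact₁ T h x (h2 _) rfl
  rw [h1 y, Ext.zero_comp]

lemma DExtVanish.of_cov₃ {X Y Z T : A} {f : X ⟶ Y} {g : Y ⟶ Z} (h : IsSES f g) {i : ℕ}
    (h1 : DExtVanish i T Y) (h2 : DExtVanish (i + 1) T X) : DExtVanish i T Z := by
  obtain ⟨w, h⟩ := h
  intro x
  obtain ⟨y, rfl⟩ := Ext.covariant_sequence_exact₃ T h x rfl (h2 _)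
  rw [h1 y, Ext.zero_comp]

lemma DExtVanish.of_contra₁ {X Y Z T : A} {f : X ⟶ Y} {g : Y ⟶ Z} (h : IsSES f g) {i : ℕ}
    (h1 : DExtVanish i Y T) (h2 : DExtVanish (1 + i) Z T) : DExtVanish i X T := by
  obtain ⟨w, h⟩ := h
  intro x
  obtain ⟨y, rfl⟩ := Ext.contravariant_sequence_exact₁ h T x rfl (h2 _)
  rw [h1 y, Ext.comp_zero]

/-- a short exact sequence with vanishing `Ext¹` splits, hence can be reversed -/
lemma IsSES.swap {X Y Z : A} {f : X ⟶ Y} {g : Y ⟶ Z} (h : IsSES f g)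
    (h1 : DExtVanish 1 Z X) : ∃ (s : Z ⟶ Y) (r : Y ⟶ X), IsSES s r := by
  have hf := h.mono
  have hg := h.epi
  obtain ⟨w, hS⟩ := id h
  obtain ⟨y, hy⟩ := Ext.covariant_sequence_exact₃ Z hS (Ext.mk₀ (𝟙 Z)) rfl (h1 _)
  obtain ⟨s, rfl⟩ := (Ext.mk₀_bijective Z Y).2 y
  have hs : s ≫ g = 𝟙 Z := by
    apply (Ext.mk₀_bijective Z Z).1
    simpa using hy
  obtain ⟨r, hr⟩ := h.lift (𝟙 Y - g ≫ s) (by simp [hs])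
  have hfr : f ≫ r = 𝟙 X := by
    rw [← cancel_mono f, Category.assoc, hr]; simp [reassoc_of% w]
  have hsr : s ≫ r = 0 := by
    rw [← cancel_mono f, Category.assoc, hr]; simp [reassoc_of% hs]
  have hsm : Mono s := mono_of_mono_fac hs
  have hre : Epi r := epi_of_epi_fac hfr
  refine ⟨s, r, IsSES.mk_ker hsr ?_⟩
  intro T t ht
  refine ⟨t ≫ g, ?_⟩
  have := congrArg (fun z => t ≫ z) hr
  simp only [reassoc_of% ht, zero_comp, Preadditive.comp_sub, Category.comp_id] at this
  rw [Category.assoc]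
  exact (sub_eq_zero.1 this.symm).symm

end ExtTools

section Main

open ZeroObject

lemma HasCoresLE.mono_set {S T : Set A} (h : S ⊆ T) {n : ℕ} {C : A} (hC : HasCoresLE S n C) :
    HasCoresLE T n C := by
  induction n generalizing C with
  | zero => exact h hC
  | succ n ih =>
    obtain ⟨X, K, f, g, hX, hs, hK⟩ := hC
    exact ⟨X, K, f, g, h hX, hs, ih hK⟩

lemma isSES_id_zero (X : A) {Z : A} (hZ : IsZero Z) : IsSES (𝟙 X) (0 : X ⟶ Z) := by
  have : Epi (0 : X ⟶ Z) := ⟨fun a b _ => hZ.eq_of_src a b⟩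
  exact IsSES.mk_ker (by simp) (fun T t _ => ⟨t, by simp⟩)

lemma isSES_iso_zero {X Y : A} (e : X ≅ Y) {Z : A} (hZ : IsZero Z) :
    IsSES e.hom (0 : Y ⟶ Z) := by
  have : Epi (0 : Y ⟶ Z) := ⟨fun a b _ => hZ.eq_of_src a b⟩
  exact IsSES.mk_ker (by simp) (fun T t _ => ⟨t ≫ e.inv, by simp⟩)

variable {𝒳 𝒲 : Set A}

lemma mem_of_isZero (hcoker : CokerClosed 𝒳) {X Z : A} (hX : X ∈ 𝒳) (hZ : IsZero Z) : Z ∈ 𝒳 :=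
  hcoker _ _ (isSES_id_zero X hZ) hX hX

lemma mem_of_iso (hX : ExtClosed 𝒳) (hcoker : CokerClosed 𝒳) {X Y : A} (h : X ∈ 𝒳) (e : X ≅ Y) :
    Y ∈ 𝒳 :=
  hX _ _ (isSES_iso_zero e (isZero_zero A)) h (mem_of_isZero hcoker h (isZero_zero A))

lemma HasCoresLE.succ (hcoker : CokerClosed 𝒳) {n : ℕ} {C : A} (hC : HasCoresLE 𝒳 n C) :
    HasCoresLE 𝒳 (n + 1) C := by
  induction n generalizing C with
  | zero =>
    exact ⟨C, 0, 𝟙 C, 0, hC, isSES_id_zero C (isZero_zero A),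
      mem_of_isZero hcoker hC (isZero_zero A)⟩
  | succ n ih =>
    obtain ⟨X, K, f, g, hX, hs, hK⟩ := hC
    exact ⟨X, K, f, g, hX, hs, ih hK⟩

lemma HasCoresLE.le (hcoker : CokerClosed 𝒳) {n m : ℕ} (h : n ≤ m) {C : A}
    (hC : HasCoresLE 𝒳 n C) : HasCoresLE 𝒳 m C := by
  induction h with
  | refl => exact hC
  | step _ ih => exact ih.succ hcoker

/-- quotient by an object of `𝒳` -/
lemma HasCoresLE.quot (hcoker : CokerClosed 𝒳) {n : ℕ} {X Q K : A} {f : X ⟶ Q} {g : Q ⟶ K}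
    (h : IsSES f g) (hX : X ∈ 𝒳) (hQ : HasCoresLE 𝒳 n Q) : HasCoresLE 𝒳 n K := by
  cases n with
  | zero => exact hcoker f g h hX hQ
  | succ n =>
    obtain ⟨Z, Q1, k, e, hZ, hs, hQ1⟩ := hQ
    obtain ⟨P, a, b, c, d, hab, hcd⟩ := h.pushout_epi hs
    exact ⟨P, Q1, c, d, hcoker a b hab hX hZ, hcd, hQ1⟩

/-- approximation -/
lemma HasCoresLE.approx (hXe : ExtClosed 𝒳) (hgen : IsGen 𝒲 𝒳) {n : ℕ} {C : A}
    (hC : HasCoresLE 𝒳 n C) :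
    ∃ (X Y : A) (f : X ⟶ Y) (g : Y ⟶ C), X ∈ 𝒳 ∧ HasCoresLE 𝒲 n Y ∧ IsSES f g := by
  induction n generalizing C with
  | zero =>
    obtain ⟨X', W₀, f, g, hW, hX', h⟩ := hgen.2 C hC
    exact ⟨X', W₀, f, g, hX', hW, h⟩
  | succ n ih =>
    obtain ⟨X0, C1, f, g, hX0, hs, hC1⟩ := hC
    obtain ⟨X1, Y1, f1, g1, hX1, hY1, hs1⟩ := ih hC1
    obtain ⟨P, a, b, c, d, hab, hcd⟩ := hs.pullback_epi hs1
    have hP : P ∈ 𝒳 := hXe c d hcd hX1 hX0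
    obtain ⟨X', W₀, f2, g2, hW, hX', h2⟩ := hgen.2 P hP
    obtain ⟨Y, a', b', c', d', hab', hcd'⟩ := h2.pullback_mono hab
    exact ⟨X', Y, a', b', hX', ⟨W₀, Y1, c', d', hW, hcd', hY1⟩, hab'⟩

lemma hasCoresLE_of_cores (hcoker : CokerClosed 𝒳)
    {n m : ℕ} {C : A} (hC : HasCoresLE 𝒳 m C)
    (h : ∀ U : A, CoresWithCokernel 𝒳 n C U → U ∈ 𝒳) : HasCoresLE 𝒳 n C := by
  induction n generalizing C m with
  | zero => exact h C ⟨Iso.refl C⟩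
  | succ n ih =>
    obtain ⟨X, K, f, g, hX, hs, hK⟩ := hC.succ hcoker
    exact ⟨X, K, f, g, hX, hs, ih hK fun U hU => h U ⟨X, K, f, g, hX, hs, hU⟩⟩

variable [HasExt.{v} A]

lemma HasCoresLE.dExtVanish
    (hproj : ∀ W ∈ 𝒲, ∀ X ∈ 𝒳, ∀ i : ℕ, DExtVanish (i + 1) W X)
    {n : ℕ} {Y X : A} (hY : HasCoresLE 𝒲 n Y) (hX : X ∈ 𝒳) (i : ℕ) :
    DExtVanish (i + 1) Y X := by
  induction n generalizing Y i with
  | zero => exact hproj Y hY X hX i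
  | succ n ih =>
    obtain ⟨W, K, f, g, hW, hs, hK⟩ := hY
    refine DExtVanish.of_contra₁ hs (hproj W hW X hX i) ?_
    rw [add_comm]
    exact ih hK (i + 1)

lemma HasCoresLE.ext (hXe : ExtClosed 𝒳) (hcoker : CokerClosed 𝒳) (hgen : IsGen 𝒲 𝒳)
    (hproj : ∀ W ∈ 𝒲, ∀ X ∈ 𝒳, ∀ i : ℕ, DExtVanish (i + 1) W X)
    {n : ℕ} {X Q C : A} {f : X ⟶ Q} {g : Q ⟶ C} (h : IsSES f g) (hX : X ∈ 𝒳)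
    (hC : HasCoresLE 𝒳 n C) : HasCoresLE 𝒳 n Q := by
  obtain ⟨X1, Y, f1, g1, hX1, hY, hs⟩ := hC.approx hXe hgen
  obtain ⟨P, a, b, c, d, hab, hcd⟩ := h.pullback_epi hs
  refine HasCoresLE.quot hcoker hcd hX1 ?_
  cases n with
  | zero => exact hXe a b hab hX (hgen.1 hY)
  | succ n =>
    obtain ⟨s, r, hsr⟩ := hab.swap (hY.dExtVanish hproj hX 0)
    obtain ⟨W, K, k, e, hW, hs', hK⟩ := hY
    obtain ⟨P', a', b', c', d', hab', hcd'⟩ := hsr.pushout_mono hs'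
    exact ⟨P', K, c', d', hXe a' b' hab' (hgen.1 hW) hX, hcd', hK.mono_set hgen.1⟩

lemma HasCoresLE.coker (hXe : ExtClosed 𝒳) (hcoker : CokerClosed 𝒳) (hgen : IsGen 𝒲 𝒳)
    (hproj : ∀ W ∈ 𝒲, ∀ X ∈ 𝒳, ∀ i : ℕ, DExtVanish (i + 1) W X)
    {n : ℕ} {X K C : A} {f : C ⟶ X} {g : X ⟶ K} (h : IsSES f g) (hX : X ∈ 𝒳)
    (hC : HasCoresLE 𝒳 (n + 1) C) : HasCoresLE 𝒳 n K := by
  obtain ⟨X0, C1, f1, g1, hX0, hs, hC1⟩ := hC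
  obtain ⟨Q, a, b, c, d, hab, hcd⟩ := h.pushout_mono hs
  exact HasCoresLE.quot hcoker hab hX0 (HasCoresLE.ext hXe hcoker hgen hproj hcd hX hC1)

/-- objects of finite coresolution dimension that are `Ext`-orthogonal to `𝒲` lie in `𝒳`. -/
lemma mem_of_dExtVanish (hXe : ExtClosed 𝒳) (hcoker : CokerClosed 𝒳) (hgen : IsGen 𝒲 𝒳)
    (hproj : ∀ W ∈ 𝒲, ∀ X ∈ 𝒳, ∀ i : ℕ, DExtVanish (i + 1) W X)
    {m : ℕ} {U : A} (hU : HasCoresLE 𝒳 m U)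
    (h : ∀ W ∈ 𝒲, ∀ i : ℕ, DExtVanish (i + 1) W U) : U ∈ 𝒳 := by
  induction m generalizing U with
  | zero => exact hU
  | succ m ih =>
    obtain ⟨X, K, f, g, hX, hs, hK⟩ := hU
    have hK' : K ∈ 𝒳 := ih hK fun W hW i =>
      DExtVanish.of_cov₃ hs (hproj W hW X hX i) (h W hW (i + 1))
    obtain ⟨X', W, f', g', hW, hX', hs'⟩ := hgen.2 K hK'
    obtain ⟨P, a, b, c, d, hab, hcd⟩ := hs.pullback_epi hs'
    obtain ⟨s, r, hsr⟩ := hab.swap (h W hW 0)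
    exact hcoker s r hsr (hgen.1 hW) (hXe c d hcd hX' hX)

lemma HasCoresLE.vanish
    (hproj : ∀ W ∈ 𝒲, ∀ X ∈ 𝒳, ∀ i : ℕ, DExtVanish (i + 1) W X)
    {n : ℕ} {C : A} (hC : HasCoresLE 𝒳 n C) :
    ∀ W ∈ 𝒲, ∀ i : ℕ, DExtVanish (n + i + 1) W C := by
  induction n generalizing C with
  | zero => exact fun W hW i => hproj W hW C hC _
  | succ n ih =>
    obtain ⟨X, K, f, g, hX, hs, hK⟩ := hC
    intro W hW i
    have h := DExtVanish.of_cov₁ hs (ih hK W hW i) (hproj W hW X hX _)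
    have e : n + 1 + i + 1 = n + i + 1 + 1 := by lia
    rw [e]
    exact h

lemma hasCoresLE_of_vanish (hXe : ExtClosed 𝒳) (hcoker : CokerClosed 𝒳) (hgen : IsGen 𝒲 𝒳)
    (hproj : ∀ W ∈ 𝒲, ∀ X ∈ 𝒳, ∀ i : ℕ, DExtVanish (i + 1) W X)
    {n m : ℕ} {C : A} (hC : HasCoresLE 𝒳 m C)
    (h : ∀ W ∈ 𝒲, ∀ i : ℕ, DExtVanish (n + i + 1) W C) : HasCoresLE 𝒳 n C := by
  induction n generalizing C m with
  | zero =>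
    refine mem_of_dExtVanish hXe hcoker hgen hproj hC fun W hW i => ?_
    have := h W hW i
    rwa [zero_add] at this
  | succ n ih =>
    obtain ⟨X, K, f, g, hX, hs, hK⟩ := hC.succ hcoker
    refine ⟨X, K, f, g, hX, hs, ih hK fun W hW i => ?_⟩
    refine DExtVanish.of_cov₃ hs (hproj W hW X hX _) ?_
    have := h W hW i
    have e : n + 1 + i + 1 = n + i + 1 + 1 := by lia
    rwa [e] at this

lemma HasCoresLE.mem_of_cores (hXe : ExtClosed 𝒳) (hcoker : CokerClosed 𝒳) (hgen : IsGen 𝒲 𝒳)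
    (hproj : ∀ W ∈ 𝒲, ∀ X ∈ 𝒳, ∀ i : ℕ, DExtVanish (i + 1) W X)
    {n : ℕ} {C U : A} (hC : HasCoresLE 𝒳 n C) (hU : CoresWithCokernel 𝒳 n C U) : U ∈ 𝒳 := by
  induction n generalizing C with
  | zero => exact mem_of_iso hXe hcoker hC hU.some
  | succ n ih =>
    obtain ⟨X, K, f, g, hX, hs, hK⟩ := hU
    exact ih (hC.coker hXe hcoker hgen hproj hs hX) hK

end Main

/-- Proposition 3.9, abelian version. -/
theorem stmt6 [EnoughProjectives A] [EnoughInjectives A]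
    (𝒳 𝒲 : Set A) (hX : ExtClosed 𝒳) (hcoker : CokerClosed 𝒳)
    (hgen : IsGen 𝒲 𝒳) (hproj : IsXProj 𝒲 𝒳)
    (C : A) (hfin : ∃ m, HasCoresLE 𝒳 m C) (n : ℕ) :
    (HasCoresLE 𝒳 n C ↔ (∀ U : A, CoresWithCokernel 𝒳 n C U → U ∈ 𝒳)) ∧
    (HasCoresLE 𝒳 n C ↔ (∀ W ∈ 𝒲, ∀ i : ℕ, 1 ≤ i → ExtVanish (n + i) W C)) := by
  have : HasExt.{v} A := hasExt_of_enoughProjectives.{v} A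
  have hproj' : ∀ W ∈ 𝒲, ∀ X ∈ 𝒳, ∀ i : ℕ, DExtVanish (i + 1) W X := fun W hW X hX i =>
    (extVanish_iff i W X).1 (hproj W hW X hX (i + 1) (by lia))
  obtain ⟨m, hm⟩ := hfin
  refine ⟨⟨fun h U hU => h.mem_of_cores hX hcoker hgen hproj' hU,
    hasCoresLE_of_cores hcoker hm⟩, ⟨fun h W hW i hi => ?_, fun h => ?_⟩⟩
  · obtain ⟨j, rfl⟩ : ∃ j, i = j + 1 := ⟨i - 1, by lia⟩
    exact (extVanish_iff (n + j) W C).2 (h.vanish hproj' W hW j)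
  · exact hasCoresLE_of_vanish hX hcoker hgen hproj' hm fun W hW i =>
      (extVanish_iff (n + i) W C).1 (h W hW (i + 1) (by lia))
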